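/- In the triple tensor product (over ℂ) of the Laurent polynomial ring Λ = ℂ[t,t⁻¹] with itself, let N be the ℂ-subspace spanned by all elements of the form a ⊗ b ⊗ c − a_{σ(1)} ⊗ a_{σ(2)} ⊗ a_{σ(3)} (where (a₁,a₂,a₃) = (a,b,c) and σ runs over all permutations of {1,2,3}) together with all elements a ⊗ b ⊗ c − (tⁿ·a) ⊗ (tⁿ·b) ⊗ (tⁿ·c) for a, b, c ∈ Λ and n ∈ ℤ. Then the images of the elements 1 ⊗ t ⊗ t^p, for integers p ≥ 1, are linearly independent over ℂ in the quotient vector space (Λ ⊗_ℂ Λ ⊗_ℂ Λ)/N; in particular this quotient contains a ℂ-subspace of countably infinite dimension. -/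

import Mathlib

open LaurentPolynomial TensorProduct

noncomputable section

/-- `Λ = ℂ[t,t⁻¹]`, the ring of Laurent polynomials over `ℂ`. -/
abbrev Λ : Type := LaurentPolynomial ℂ

/-- The triple tensor product `Λ ⊗_ℂ Λ ⊗_ℂ Λ`. -/
abbrev TripleTensor : Type := Λ ⊗[ℂ] (Λ ⊗[ℂ] Λ)

-- Help instance search, which otherwise stalls on this large type.
instance : HasQuotient TripleTensor (Submodule ℂ TripleTensor) := Submodule.hasQuotient

/-- The elementary tensor `a ⊗ b ⊗ c` in the triple tensor product `Λ ⊗_ℂ Λ ⊗_ℂ Λ`. -/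
def trip (a b c : Λ) : TripleTensor := a ⊗ₜ[ℂ] (b ⊗ₜ[ℂ] c)

/-- The subspace `N` of `Λ ⊗_ℂ Λ ⊗_ℂ Λ` spanned by the symmetrization relations
`a ⊗ b ⊗ c − a_{σ(1)} ⊗ a_{σ(2)} ⊗ a_{σ(3)}` and by the relations
`a ⊗ b ⊗ c − (tⁿ·a) ⊗ (tⁿ·b) ⊗ (tⁿ·c)`. -/
def relN : Submodule ℂ TripleTensor :=
  Submodule.span ℂ
    ({x | ∃ (a : Fin 3 → Λ) (σ : Equiv.Perm (Fin 3)),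
        x = trip (a 0) (a 1) (a 2) - trip (a (σ 0)) (a (σ 1)) (a (σ 2))} ∪
     {x | ∃ (a b c : Λ) (n : ℤ),
        x = trip a b c - trip (T n * a) (T n * b) (T n * c)})

/-- The monomial basis `(tⁿ)` of the Laurent polynomial ring. -/
def monomialBasis : Module.Basis ℤ ℂ Λ := AddMonoidAlgebra.basis ℤ ℂ

/-- The linear map sending `tⁱ ⊗ tʲ ⊗ tᵏ` to the basis vector indexed by the spread
`max (i, j, k) - min (i, j, k)`. -/
def spreadMap : TripleTensor →ₗ[ℂ] (ℤ →₀ ℂ) :=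
  (monomialBasis.tensorProduct (monomialBasis.tensorProduct monomialBasis)).constr ℂ
    fun x => Finsupp.single (max x.1 (max x.2.1 x.2.2) - min x.1 (min x.2.1 x.2.2)) 1

lemma monomialBasis_apply (n : ℤ) : monomialBasis n = T n :=
  AddMonoidAlgebra.basis_apply ..

lemma spreadMap_trip_T (i j k : ℤ) :
    spreadMap (trip (T i) (T j) (T k)) =
      Finsupp.single (max i (max j k) - min i (min j k)) 1 := by
  have h := (monomialBasis.tensorProduct
    (monomialBasis.tensorProduct monomialBasis)).constr_basis ℂ
    (fun x => Finsupp.single (max x.1 (max x.2.1 x.2.2) - min x.1 (min x.2.1 x.2.2)) (1 : ℂ))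
    (i, j, k)
  rw [Module.Basis.tensorProduct_apply, Module.Basis.tensorProduct_apply] at h
  simp only [monomialBasis_apply] at h
  exact h

lemma tripleTensor_ext {M : Type*} [AddCommMonoid M] [Module ℂ M] {f g : TripleTensor →ₗ[ℂ] M}
    (h : ∀ i j k : ℤ, f (trip (T i) (T j) (T k)) = g (trip (T i) (T j) (T k))) : f = g := by
  refine (monomialBasis.tensorProduct
    (monomialBasis.tensorProduct monomialBasis)).ext fun ⟨i, j, k⟩ => ?_
  rw [Module.Basis.tensorProduct_apply, Module.Basis.tensorProduct_apply]
  simp only [monomialBasis_apply]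
  exact h i j k

lemma spreadMap_swap_left (a b c : Λ) :
    spreadMap (trip b a c) = spreadMap (trip a b c) := by
  have h : spreadMap ∘ₗ (TensorProduct.leftComm ℂ Λ Λ Λ).toLinearMap = spreadMap :=
    tripleTensor_ext fun i j k => by
      change spreadMap (trip (T j) (T i) (T k)) = _
      rw [spreadMap_trip_T, spreadMap_trip_T, max_left_comm, min_left_comm]
  exact DFunLike.congr_fun h (trip a b c)

lemma spreadMap_swap_right (a b c : Λ) :
    spreadMap (trip a c b) = spreadMap (trip a b c) := by
  have h : spreadMap ∘ₗ LinearMap.lTensor Λ (TensorProduct.comm ℂ Λ Λ).toLinearMap = spreadMap :=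
    tripleTensor_ext fun i j k => by
      change spreadMap (trip (T i) (T k) (T j)) = _
      rw [spreadMap_trip_T, spreadMap_trip_T, max_comm k j, min_comm k j]
  exact DFunLike.congr_fun h (trip a b c)

lemma map_trip (m : Λ →ₗ[ℂ] Λ) (a b c : Λ) :
    TensorProduct.map m (TensorProduct.map m m) (trip a b c) = trip (m a) (m b) (m c) :=
  rfl

lemma spreadMap_shift (n : ℤ) (a b c : Λ) :
    spreadMap (trip (T n * a) (T n * b) (T n * c)) = spreadMap (trip a b c) := by
  have h : spreadMap ∘ₗ TensorProduct.map (LinearMap.mulLeft ℂ (T n))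
      (TensorProduct.map (LinearMap.mulLeft ℂ (T n)) (LinearMap.mulLeft ℂ (T n))) = spreadMap :=
    tripleTensor_ext fun i j k => by
      rw [LinearMap.comp_apply, map_trip]
      simp only [LinearMap.mulLeft_apply]
      rw [← T_add, ← T_add, ← T_add, spreadMap_trip_T, spreadMap_trip_T]
      congr 1
      omega
  have h' := DFunLike.congr_fun h (trip a b c)
  rw [LinearMap.comp_apply, map_trip] at h'
  simpa only [LinearMap.mulLeft_apply] using h'

lemma apply_perm_fin_three {α β : Type*} (f : α → α → α → β)
    (hl : ∀ a b c, f b a c = f a b c) (hr : ∀ a b c, f a c b = f a b c)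
    (a : Fin 3 → α) (σ : Equiv.Perm (Fin 3)) :
    f (a (σ 0)) (a (σ 1)) (a (σ 2)) = f (a 0) (a 1) (a 2) := by
  have h01 : σ 0 ≠ σ 1 := σ.injective.ne (by decide)
  have h02 : σ 0 ≠ σ 2 := σ.injective.ne (by decide)
  have h12 : σ 1 ≠ σ 2 := σ.injective.ne (by decide)
  generalize σ 0 = x at *
  generalize σ 1 = y at *
  generalize σ 2 = z at *
  fin_cases x <;> fin_cases y <;> fin_cases z <;> grind

lemma spreadMap_perm (a : Fin 3 → Λ) (σ : Equiv.Perm (Fin 3)) :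
    spreadMap (trip (a (σ 0)) (a (σ 1)) (a (σ 2))) = spreadMap (trip (a 0) (a 1) (a 2)) :=
  apply_perm_fin_three (fun a b c => spreadMap (trip a b c))
    spreadMap_swap_left spreadMap_swap_right a σ

lemma relN_le_ker_spreadMap : relN ≤ LinearMap.ker spreadMap := by
  refine Submodule.span_le.2 ?_
  rintro x (⟨a, σ, rfl⟩ | ⟨a, b, c, n, rfl⟩)
  · exact LinearMap.mem_ker.2 (by rw [map_sub, spreadMap_perm, sub_self])
  · exact LinearMap.mem_ker.2 (by rw [map_sub, spreadMap_shift, sub_self])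

lemma linearIndependent_theta :
    LinearIndependent ℂ
      (fun p : {p : ℤ // 1 ≤ p} =>
        Submodule.Quotient.mk (p := relN) (trip 1 (T 1) (T p.1))) := by
  have h : LinearIndependent ℂ
      (fun p : {p : ℤ // 1 ≤ p} => (Finsupp.single p.1 1 : ℤ →₀ ℂ)) :=
    (Finsupp.linearIndependent_single_one ℂ ℤ).comp _ Subtype.val_injective
  have hcomp : (relN.liftQ spreadMap relN_le_ker_spreadMap) ∘
      (fun p : {p : ℤ // 1 ≤ p} => Submodule.Quotient.mk (p := relN) (trip 1 (T 1) (T p.1))) =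
      fun p => Finsupp.single p.1 1 := by
    funext ⟨p, hp⟩
    change spreadMap (trip 1 (T 1) (T p)) = Finsupp.single p 1
    rw [← T_zero, spreadMap_trip_T]
    congr 1
    omega
  exact LinearIndependent.of_comp (relN.liftQ spreadMap relN_le_ker_spreadMap) (hcomp ▸ h)

/-- The images of `1 ⊗ t ⊗ t^p` (for integers `p ≥ 1`) in `(Λ ⊗_ℂ Λ ⊗_ℂ Λ)/N` are
linearly independent over `ℂ`; in particular this quotient contains a `ℂ`-subspace of
countably infinite dimension. -/
theorem theta_sym_classes_linearIndependent :
    LinearIndependent ℂ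
      (fun p : {p : ℤ // 1 ≤ p} =>
        Submodule.Quotient.mk (p := relN) (trip 1 (T 1) (T p.1))) ∧
    ∃ V : Submodule ℂ (TripleTensor ⧸ relN), Module.rank ℂ V = Cardinal.aleph0 := by
  refine ⟨linearIndependent_theta, Submodule.span ℂ (Set.range _),
    (rank_span linearIndependent_theta).trans ?_⟩
  rw [Cardinal.mk_range_eq _ linearIndependent_theta.injective]
  have : Infinite {p : ℤ // 1 ≤ p} := (Set.Ici_infinite (1 : ℤ)).to_subtype
  exact Cardinal.mk_eq_aleph0 _

end
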